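/- arXiv:1608.02348 — 5 statements merged into one kernel-verified Lean document; each statement's English description precedes it below -/
import Mathlib

section
/- Under the GBDT setup, the matrix identity propagates along the flow: for every x in [0,ℓ) one has A₁S(x) − S(x)A₂ = Π₁(x)Π₂(x)*. -/
open Matrix Set

attribute [local instance] Matrix.normedAddCommGroup Matrix.normedSpace

/-- Product rule for matrix-valued functions of a real variable. -/
theorem Matrix.hasDerivAt_mul {l m n : Type*} [Fintype l] [Fintype m] [Fintype n]
    {A : ℝ → Matrix l m ℂ} {B : ℝ → Matrix m n ℂ} {A' : Matrix l m ℂ} {B' : Matrix m n ℂ} {x : ℝ}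
    (hA : HasDerivAt A A' x) (hB : HasDerivAt B B' x) :
    HasDerivAt (fun t => A t * B t) (A' * B x + A x * B') x := by
  refine hasDerivAt_pi.2 fun i => hasDerivAt_pi.2 fun j => ?_
  have hA' (k : m) : HasDerivAt (fun t => A t i k) (A' i k) x :=
    hasDerivAt_pi.1 (hasDerivAt_pi.1 hA i) k
  have hB' (k : m) : HasDerivAt (fun t => B t k j) (B' k j) x :=
    hasDerivAt_pi.1 (hasDerivAt_pi.1 hB k) j
  have h := HasDerivAt.fun_sum (u := Finset.univ) fun k _ => (hA' k).fun_mul (hB' k)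
  simpa only [Matrix.add_apply, Matrix.mul_apply, Finset.sum_add_distrib] using h

/-- **GBDT matrix identity propagation.**  Under the GBDT setup (parameter matrices
`A₁, A₂, S 0, Pi1 0, Pi2 0` satisfying `A₁ S(0) − S(0) A₂ = Pi1(0) Pi2(0)*`, and `Pi1, Pi2, S`
solving the GBDT differential equations `Pi1' = A₁ Pi1 Q₁ + Pi1 Q₀`,
`(Pi2*)' = −Q₁ Pi2* A₂ − Q₀ Pi2*`, `S' = Pi1 Q₁ Pi2*` on `[0, ℓ)`), the matrix identity
`A₁ S(x) − S(x) A₂ = Pi1(x) Pi2(x)*` holds for every `x ∈ [0, ℓ)`. -/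
theorem gbdt_matrix_identity_propagates
    (n m : ℕ) (ℓ : ℝ)
    (Q₁ Q₀ : ℝ → Matrix (Fin m) (Fin m) ℂ)
    (A₁ A₂ : Matrix (Fin n) (Fin n) ℂ)
    (Pi1 Pi2 : ℝ → Matrix (Fin n) (Fin m) ℂ)
    (S : ℝ → Matrix (Fin n) (Fin n) ℂ)
    (hInit : A₁ * S 0 - S 0 * A₂ = Pi1 0 * (Pi2 0)ᴴ)
    (hPi1 : ∀ x ∈ Ico (0 : ℝ) ℓ,
      HasDerivAt Pi1 (A₁ * Pi1 x * Q₁ x + Pi1 x * Q₀ x) x)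
    (hPi2 : ∀ x ∈ Ico (0 : ℝ) ℓ,
      HasDerivAt (fun t => (Pi2 t)ᴴ) (-(Q₁ x * (Pi2 x)ᴴ * A₂) - Q₀ x * (Pi2 x)ᴴ) x)
    (hS : ∀ x ∈ Ico (0 : ℝ) ℓ,
      HasDerivAt S (Pi1 x * Q₁ x * (Pi2 x)ᴴ) x) :
    ∀ x ∈ Ico (0 : ℝ) ℓ, A₁ * S x - S x * A₂ = Pi1 x * (Pi2 x)ᴴ := by
  have hF : ∀ x ∈ Ico (0 : ℝ) ℓ,
      HasDerivAt (fun t => A₁ * S t - S t * A₂ - Pi1 t * (Pi2 t)ᴴ) 0 x := by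
    intro x hx
    have h := ((Matrix.hasDerivAt_mul (hasDerivAt_const x A₁) (hS x hx)).sub
      (Matrix.hasDerivAt_mul (hS x hx) (hasDerivAt_const x A₂))).sub
      (Matrix.hasDerivAt_mul (hPi1 x hx) (hPi2 x hx))
    refine h.congr_deriv ?_
    simp only [Matrix.zero_mul, Matrix.mul_zero, Matrix.add_mul, Matrix.mul_sub, Matrix.mul_neg,
      Matrix.mul_assoc]
    abel
  intro x hx
  have hsub : Icc 0 x ⊆ Ico 0 ℓ := fun y hy => ⟨hy.1, hy.2.trans_lt hx.2⟩
  have hconst := constant_of_has_deriv_right_zero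
    (fun y hy => (hF y (hsub hy)).continuousAt.continuousWithinAt)
    (fun y hy => (hF y (hsub (Ico_subset_Icc_self hy))).hasDerivWithinAt) x ⟨hx.1, le_rfl⟩
  rw [sub_eq_zero.2 hInit] at hconst
  exact sub_eq_zero.1 hconst
end

section
/- The Darboux matrix w_A(x,λ) = I_m − Π₂(x)*S(x)⁻¹(A₁ − λI_n)⁻¹Π₁(x) satisfies, at every x ∈ [0,ℓ) where S(x) and (A₁ − λI_n) are invertible, the differential equation (d/dx) w_A(x,λ) = F̃(x,λ) w_A(x,λ) − w_A(x,λ) F(x,λ), where F(x,λ) = −(λQ₁(x) + Q₀(x)), F̃(x,λ) = −(λQ₁(x) + Q̃₀(x)), Q̃₀(x) = Q₀(x) − (Q₁(x)X(x) − X(x)Q₁(x)), and X(x) = Π₂(x)*S(x)⁻¹Π₁(x). -/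
open Matrix Set

attribute [local instance] Matrix.normedAddCommGroup Matrix.normedSpace

namespace Matrix

theorem hasDerivAt_iff_entry {k l : Type*} [Finite k] [Fintype l] {f : ℝ → Matrix k l ℂ} {f' : Matrix k l ℂ} {x : ℝ} :
    HasDerivAt f f' x ↔ ∀ i j, HasDerivAt (fun t => f t i j) (f' i j) x :=
  (hasDerivAt_pi (φ := f) (φ' := f')).trans (forall_congr' fun _ => hasDerivAt_pi)

theorem hasDerivAt_mul_s1 {k l p : Type*} [Fintype k] [Fintype l] [Fintype p]
    {f : ℝ → Matrix k l ℂ} {g : ℝ → Matrix l p ℂ} {f' : Matrix k l ℂ}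
    {g' : Matrix l p ℂ} {x : ℝ} (hf : HasDerivAt f f' x) (hg : HasDerivAt g g' x) :
    HasDerivAt (fun t => f t * g t) (f' * g x + f x * g') x := by
  rw [hasDerivAt_iff_entry] at *
  intro i j
  simp only [mul_apply, add_apply, ← Finset.sum_add_distrib]
  exact HasDerivAt.fun_sum fun r _ => (hf i r).mul (hg r j)

theorem hasDerivAt_inv {k : Type*} [Fintype k] [DecidableEq k] {f : ℝ → Matrix k k ℂ} {f' : Matrix k k ℂ} {x : ℝ}
    (hf : HasDerivAt f f' x) (hx : IsUnit (f x)) :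
    HasDerivAt (fun t => (f t)⁻¹) (-((f x)⁻¹ * f' * (f x)⁻¹)) x := by
  let _ : NormedRing (Matrix k k ℂ) := Matrix.linftyOpNormedRing
  let _ : NormedAlgebra ℝ (Matrix k k ℂ) := Matrix.linftyOpNormedAlgebra
  have : HasSummableGeomSeries (Matrix k k ℂ) :=
    @instHasSummableGeomSeriesOfCompleteSpace _ _ (FiniteDimensional.complete ℝ _)
  obtain ⟨u, hu⟩ := hx
  have h := hasFDerivAt_ringInverse (𝕜 := ℝ) u
  rw [hu] at h
  have h' := h.comp_hasDerivAt x hf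
  have hinv : ((u⁻¹ : (Matrix k k ℂ)ˣ) : Matrix k k ℂ) = (f x)⁻¹ := by
    rw [← hu, coe_units_inv]
  rw [hinv] at h'
  simp only [nonsing_inv_eq_ringInverse] at *
  exact h'

end Matrix

/-- The identity `A₁ S - S A₂ = Π₁ Π₂*` is preserved along the flow; here `P` stands for `Π₂*`. -/
theorem gbdt_identity {k l : Type*} [Fintype k] [Fintype l] {ℓ : ℝ}
    {Q₁ Q₀ : ℝ → Matrix l l ℂ} {A₁ A₂ : Matrix k k ℂ}
    {Pi1 : ℝ → Matrix k l ℂ} {P : ℝ → Matrix l k ℂ} {S : ℝ → Matrix k k ℂ}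
    (hInit : A₁ * S 0 - S 0 * A₂ = Pi1 0 * P 0)
    (hPi1 : ∀ x ∈ Ico (0 : ℝ) ℓ, HasDerivAt Pi1 (A₁ * Pi1 x * Q₁ x + Pi1 x * Q₀ x) x)
    (hP : ∀ x ∈ Ico (0 : ℝ) ℓ, HasDerivAt P (-(Q₁ x * P x * A₂) - Q₀ x * P x) x)
    (hS : ∀ x ∈ Ico (0 : ℝ) ℓ, HasDerivAt S (Pi1 x * Q₁ x * P x) x)
    {x : ℝ} (hx : x ∈ Ico (0 : ℝ) ℓ) : A₁ * S x - S x * A₂ = Pi1 x * P x := by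
  have hderiv : ∀ y ∈ Ico (0 : ℝ) ℓ,
      HasDerivAt (fun t => A₁ * S t - S t * A₂ - Pi1 t * P t) 0 y := by
    intro y hy
    have h := ((hasDerivAt_mul_s1 (hasDerivAt_const y A₁) (hS y hy)).sub
      (hasDerivAt_mul_s1 (hS y hy) (hasDerivAt_const y A₂))).sub
      (hasDerivAt_mul_s1 (hPi1 y hy) (hP y hy))
    refine h.congr_deriv ?_
    simp only [Matrix.add_mul, Matrix.mul_sub, Matrix.mul_neg, Matrix.zero_mul, Matrix.mul_zero,
      Matrix.mul_assoc]
    abel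
  have hsub : Icc 0 x ⊆ Ico 0 ℓ := fun y hy => ⟨hy.1, hy.2.trans_lt hx.2⟩
  have hconst := constant_of_has_deriv_right_zero
    (fun y hy => (hderiv y (hsub hy)).continuousAt.continuousWithinAt)
    (fun y hy => (hderiv y (hsub (Ico_subset_Icc_self hy))).hasDerivWithinAt)
    x (right_mem_Icc.mpr hx.1)
  rwa [hInit, sub_self, sub_eq_zero] at hconst

/-- **The Darboux matrix satisfies its differential equation.**  Under the GBDT setup, the
Darboux matrix `w_A(x,λ) = I − Π₂(x)* S(x)⁻¹ (A₁ − λ I)⁻¹ Π₁(x)` satisfies, at every point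
`x ∈ [0,ℓ)` where `S(x)` and `A₁ − λ I` are invertible,
`(d/dx) w_A(x,λ) = F̃(x,λ) w_A(x,λ) − w_A(x,λ) F(x,λ)`, where
`F(x,λ) = −(λ Q₁(x) + Q₀(x))`, `F̃(x,λ) = −(λ Q₁(x) + Q̃₀(x))`,
`Q̃₀ = Q₀ − (Q₁ X − X Q₁)` and `X = Π₂* S⁻¹ Π₁`. -/
theorem gbdt_darboux_matrix_deriv
    (n m : ℕ) (ℓ : ℝ) (lam : ℂ)
    (Q₁ Q₀ : ℝ → Matrix (Fin m) (Fin m) ℂ)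
    (A₁ A₂ : Matrix (Fin n) (Fin n) ℂ)
    (Pi1 Pi2 : ℝ → Matrix (Fin n) (Fin m) ℂ)
    (S : ℝ → Matrix (Fin n) (Fin n) ℂ)
    (hInit : A₁ * S 0 - S 0 * A₂ = Pi1 0 * (Pi2 0)ᴴ)
    (hPi1 : ∀ x ∈ Ico (0 : ℝ) ℓ,
      HasDerivAt Pi1 (A₁ * Pi1 x * Q₁ x + Pi1 x * Q₀ x) x)
    (hPi2 : ∀ x ∈ Ico (0 : ℝ) ℓ,
      HasDerivAt (fun t => (Pi2 t)ᴴ) (-(Q₁ x * (Pi2 x)ᴴ * A₂) - Q₀ x * (Pi2 x)ᴴ) x)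
    (hS : ∀ x ∈ Ico (0 : ℝ) ℓ,
      HasDerivAt S (Pi1 x * Q₁ x * (Pi2 x)ᴴ) x)
    -- the Darboux matrix, the transformed coefficient and the two coefficient matrices
    (wA : ℝ → Matrix (Fin m) (Fin m) ℂ)
    (hwA : wA = fun x => 1 - (Pi2 x)ᴴ * (S x)⁻¹ * (A₁ - lam • 1)⁻¹ * Pi1 x)
    (X : ℝ → Matrix (Fin m) (Fin m) ℂ)
    (hX : X = fun x => (Pi2 x)ᴴ * (S x)⁻¹ * Pi1 x)
    (F Ft : ℝ → Matrix (Fin m) (Fin m) ℂ)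
    (hF : F = fun x => -(lam • Q₁ x + Q₀ x))
    (hFt : Ft = fun x => -(lam • Q₁ x + (Q₀ x - (Q₁ x * X x - X x * Q₁ x)))) :
    ∀ x ∈ Ico (0 : ℝ) ℓ, IsUnit (S x) → IsUnit (A₁ - lam • 1) →
      HasDerivAt wA (Ft x * wA x - wA x * F x) x := by
  intro x hx hSx hA
  set R := (A₁ - lam • 1)⁻¹ with hR
  set T := (S x)⁻¹ with hT
  set P := (Pi2 x)ᴴ with hP
  have hdS : IsUnit (S x).det := (isUnit_iff_isUnit_det _).mp hSx
  have hAR : A₁ * R = 1 + lam • R := by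
    have h := mul_nonsing_inv _ ((isUnit_iff_isUnit_det _).mp hA)
    rw [← hR, Matrix.sub_mul, Matrix.smul_mul, Matrix.one_mul] at h
    rw [← h, sub_add_cancel]
  have hRA : R * A₁ = 1 + lam • R := by
    have h := nonsing_inv_mul _ ((isUnit_iff_isUnit_det _).mp hA)
    rw [← hR, Matrix.mul_sub, Matrix.mul_smul, Matrix.mul_one] at h
    rw [← h, sub_add_cancel]
  have hAT : A₂ * T = T * A₁ - T * (Pi1 x * P) * T := by
    rw [← gbdt_identity hInit hPi1 hPi2 hS hx, Matrix.mul_sub, Matrix.sub_mul,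
      ← Matrix.mul_assoc T (S x), nonsing_inv_mul _ hdS, Matrix.one_mul, Matrix.mul_assoc T,
      Matrix.mul_assoc A₁, mul_nonsing_inv _ hdS, Matrix.mul_one, sub_sub_cancel]
  have hderiv := (hasDerivAt_mul_s1 (hasDerivAt_mul_s1 (hasDerivAt_mul_s1 (hPi2 x hx)
    (hasDerivAt_inv (hS x hx) hSx)) (hasDerivAt_const x R)) (hPi1 x hx)).const_sub 1
  subst hwA hX hF hFt
  refine hderiv.congr_deriv ?_
  simp only [← hT, ← hP]
  have hATM (M : Matrix (Fin n) (Fin m) ℂ) :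
      A₂ * (T * M) = T * (A₁ * M) - T * (Pi1 x * (P * (T * M))) := by
    simpa only [Matrix.sub_mul, Matrix.mul_assoc] using congrArg (· * M) hAT
  have hARM (M : Matrix (Fin n) (Fin m) ℂ) : A₁ * (R * M) = M + lam • (R * M) := by
    rw [← Matrix.mul_assoc, hAR, Matrix.add_mul, Matrix.one_mul, Matrix.smul_mul]
  have hRAM (M : Matrix (Fin n) (Fin m) ℂ) : R * (A₁ * M) = M + lam • (R * M) := by
    rw [← Matrix.mul_assoc, hRA, Matrix.add_mul, Matrix.one_mul, Matrix.smul_mul]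
  simp only [Matrix.mul_add, Matrix.add_mul, Matrix.mul_sub, Matrix.sub_mul, Matrix.mul_neg,
    Matrix.neg_mul, Matrix.zero_mul, Matrix.mul_zero, Matrix.mul_one, Matrix.one_mul,
    Matrix.mul_assoc, hATM, hARM, hRAM, Matrix.smul_mul, Matrix.mul_smul]
  module
end

section
/- Theorem (GBDT for first-order systems linear in the spectral parameter): if y(x,λ) satisfies y′(x,λ) = F(x,λ)y(x,λ) with F(x,λ) = −(λQ₁(x) + Q₀(x)), then the function ỹ(x,λ) := w_A(x,λ)y(x,λ), with w_A(x,λ) = I_m − Π₂(x)*S(x)⁻¹(A₁ − λI_n)⁻¹Π₁(x), satisfies at every point x where S(x) and (A₁ − λI_n) are invertible the transformed system ỹ′(x,λ) = F̃(x,λ)ỹ(x,λ), where F̃(x,λ) = −(λQ₁(x) + Q̃₀(x)), Q̃₀(x) = Q₀(x) − (Q₁(x)X(x) − X(x)Q₁(x)), X(x) = Π₂(x)*S(x)⁻¹Π₁(x). -/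
open Matrix Set

attribute [local instance] Matrix.normedAddCommGroup Matrix.normedSpace

/-- The product rule for matrix functions. -/
theorem HasDerivAt.matrix_mul {l m n : Type*} [Fintype l] [Fintype m] [Fintype n]
    {f : ℝ → Matrix l m ℂ} {g : ℝ → Matrix m n ℂ} {f' : Matrix l m ℂ} {g' : Matrix m n ℂ} {x : ℝ}
    (hf : HasDerivAt f f' x) (hg : HasDerivAt g g' x) :
    HasDerivAt (fun t => f t * g t) (f' * g x + f x * g') x := by
  refine hasDerivAt_pi.2 fun i => hasDerivAt_pi.2 fun j => ?_
  simp only [Matrix.add_apply, Matrix.mul_apply, ← Finset.sum_add_distrib]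
  exact HasDerivAt.fun_sum fun k _ =>
    (hasDerivAt_pi.1 (hasDerivAt_pi.1 hf i) k).mul (hasDerivAt_pi.1 (hasDerivAt_pi.1 hg k) j)

/-- The product rule for a matrix function applied to a vector function. -/
theorem HasDerivAt.matrix_mulVec {l m : Type*} [Fintype l] [Fintype m]
    {f : ℝ → Matrix l m ℂ} {g : ℝ → m → ℂ} {f' : Matrix l m ℂ} {g' : m → ℂ} {x : ℝ}
    (hf : HasDerivAt f f' x) (hg : HasDerivAt g g' x) :
    HasDerivAt (fun t => f t *ᵥ g t) (f' *ᵥ g x + f x *ᵥ g') x := by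
  refine hasDerivAt_pi.2 fun i => ?_
  simp only [Pi.add_apply, Matrix.mulVec, dotProduct, ← Finset.sum_add_distrib]
  exact HasDerivAt.fun_sum fun k _ =>
    (hasDerivAt_pi.1 (hasDerivAt_pi.1 hf i) k).mul (hasDerivAt_pi.1 hg k)

/-- The derivative of the inverse of a function with values in a complete normed algebra. -/
theorem HasDerivAt.ringInverse {R : Type*} [NormedRing R] [NormedAlgebra ℝ R] [CompleteSpace R]
    {f : ℝ → R} {f' : R} {x : ℝ} (hf : HasDerivAt f f' x) (hu : IsUnit (f x)) :
    HasDerivAt (fun t => Ring.inverse (f t))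
      (-(Ring.inverse (f x) * f' * Ring.inverse (f x))) x := by
  obtain ⟨u, hu⟩ := hu
  have h := hasFDerivAt_ringInverse (𝕜 := ℝ) u
  rw [hu] at h
  rw [← hu, Ring.inverse_unit]
  exact h.comp_hasDerivAt x hf

/-- The derivative of the inverse of a matrix function. The topology on matrices induced by the
`ℓ^∞` operator norm is definitionally the entrywise one, so the statement does not depend on the
choice of the norm. -/
theorem HasDerivAt.matrix_inv {n : Type*} [Fintype n] [DecidableEq n]
    {f : ℝ → Matrix n n ℂ} {f' : Matrix n n ℂ} {x : ℝ}
    (hf : HasDerivAt f f' x) (hu : IsUnit (f x)) :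
    HasDerivAt (fun t => (f t)⁻¹) (-((f x)⁻¹ * f' * (f x)⁻¹)) x := by
  let _ : NormedRing (Matrix n n ℂ) := Matrix.linftyOpNormedRing
  let _ : NormedAlgebra ℝ (Matrix n n ℂ) := Matrix.linftyOpNormedAlgebra
  have hc : @CompleteSpace (Matrix n n ℂ)
      Matrix.linftyOpNormedRing.toPseudoMetricSpace.toUniformSpace :=
    (inferInstance : CompleteSpace (n → n → ℂ))
  simp only [Matrix.nonsing_inv_eq_ringInverse]
  exact HasDerivAt.ringInverse hf hu

/-- The GBDT operator identity `A₁ S - S A₂ = Π₁ Π₂*`, with `P = Π₂*`, propagates from `0`. -/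
theorem gbdt_operator_identity {n m : Type*} [Fintype n] [Fintype m] {ℓ : ℝ}
    {Q₁ Q₀ : ℝ → Matrix m m ℂ} {A₁ A₂ : Matrix n n ℂ}
    {Pi1 : ℝ → Matrix n m ℂ} {P : ℝ → Matrix m n ℂ} {S : ℝ → Matrix n n ℂ}
    (hInit : A₁ * S 0 - S 0 * A₂ = Pi1 0 * P 0)
    (hPi1 : ∀ x ∈ Ico (0 : ℝ) ℓ, HasDerivAt Pi1 (A₁ * Pi1 x * Q₁ x + Pi1 x * Q₀ x) x)
    (hP : ∀ x ∈ Ico (0 : ℝ) ℓ, HasDerivAt P (-(Q₁ x * P x * A₂) - Q₀ x * P x) x)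
    (hS : ∀ x ∈ Ico (0 : ℝ) ℓ, HasDerivAt S (Pi1 x * Q₁ x * P x) x) :
    ∀ x ∈ Ico (0 : ℝ) ℓ, A₁ * S x - S x * A₂ = Pi1 x * P x := by
  intro x hx
  have hD : ∀ t ∈ Ico (0 : ℝ) ℓ,
      HasDerivAt (fun t => A₁ * S t - S t * A₂ - Pi1 t * P t) 0 t := by
    intro t ht
    have h := (((hasDerivAt_const t A₁).matrix_mul (hS t ht)).sub
      ((hS t ht).matrix_mul (hasDerivAt_const t A₂))).sub ((hPi1 t ht).matrix_mul (hP t ht))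
    refine h.congr_deriv ?_
    simp only [Matrix.zero_mul, Matrix.mul_zero, Matrix.mul_sub, Matrix.add_mul, Matrix.mul_neg,
      Matrix.mul_assoc]
    abel
  have hc := constant_of_has_deriv_right_zero (a := 0) (b := x)
    (fun t ht => (hD t ⟨ht.1, ht.2.trans_lt hx.2⟩).continuousAt.continuousWithinAt)
    (fun t ht => (hD t ⟨ht.1, ht.2.trans hx.2⟩).hasDerivWithinAt) x ⟨hx.1, le_rfl⟩
  rw [sub_eq_zero.2 hInit] at hc
  exact sub_eq_zero.1 hc

/-- The derivative of the Darboux matrix `1 - P S⁻¹ (A₁ - λ)⁻¹ Π₁`, where `P = Π₂*`. -/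
theorem gbdt_hasDerivAt_darboux {n m : Type*} [Fintype n] [DecidableEq n] [Fintype m]
    [DecidableEq m] {x : ℝ} {lam : ℂ} {Q₁ Q₀ : Matrix m m ℂ} {A₁ A₂ : Matrix n n ℂ}
    {Pi1 : ℝ → Matrix n m ℂ} {P : ℝ → Matrix m n ℂ} {S : ℝ → Matrix n n ℂ}
    (hPi1 : HasDerivAt Pi1 (A₁ * Pi1 x * Q₁ + Pi1 x * Q₀) x)
    (hP : HasDerivAt P (-(Q₁ * P x * A₂) - Q₀ * P x) x)
    (hS : HasDerivAt S (Pi1 x * Q₁ * P x) x)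
    (hId : A₁ * S x - S x * A₂ = Pi1 x * P x)
    (hSu : IsUnit (S x)) (hAu : IsUnit (A₁ - lam • 1))
    {w X : Matrix m m ℂ} (hw : w = 1 - P x * (S x)⁻¹ * (A₁ - lam • 1)⁻¹ * Pi1 x)
    (hX : X = P x * (S x)⁻¹ * Pi1 x) :
    HasDerivAt (fun t => 1 - P t * (S t)⁻¹ * (A₁ - lam • 1)⁻¹ * Pi1 t)
      (-(lam • Q₁ + (Q₀ - (Q₁ * X - X * Q₁))) * w + w * (lam • Q₁ + Q₀)) x := by
  have h := (hasDerivAt_const x (1 : Matrix m m ℂ)).sub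
    (((hP.matrix_mul (hS.matrix_inv hSu)).matrix_mul
      (hasDerivAt_const x (A₁ - lam • 1)⁻¹)).matrix_mul hPi1)
  refine h.congr_deriv ?_
  set T := (S x)⁻¹ with hT
  set R := (A₁ - lam • 1)⁻¹ with hR
  have hST : S x * T = 1 := Matrix.mul_nonsing_inv _ ((Matrix.isUnit_iff_isUnit_det _).1 hSu)
  have hTS : T * S x = 1 := Matrix.nonsing_inv_mul _ ((Matrix.isUnit_iff_isUnit_det _).1 hSu)
  have hAR : A₁ * R = 1 + lam • R := by
    have := Matrix.mul_nonsing_inv _ ((Matrix.isUnit_iff_isUnit_det _).1 hAu)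
    rw [← hR, Matrix.sub_mul, Matrix.smul_mul, Matrix.one_mul] at this
    exact sub_eq_iff_eq_add.1 this
  have hRA : R * A₁ = 1 + lam • R := by
    have := Matrix.nonsing_inv_mul _ ((Matrix.isUnit_iff_isUnit_det _).1 hAu)
    rw [← hR, Matrix.mul_sub, Matrix.mul_smul, Matrix.mul_one] at this
    exact sub_eq_iff_eq_add.1 this
  have hAT : A₂ * T = T * A₁ - T * Pi1 x * P x * T := by
    rw [Matrix.mul_assoc T, ← hId, Matrix.mul_sub, Matrix.sub_mul, ← Matrix.mul_assoc T (S x) A₂,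
      hTS, Matrix.one_mul, Matrix.mul_assoc T, Matrix.mul_assoc A₁, hST, Matrix.mul_one]
    abel
  have hPT : (-(Q₁ * P x * A₂) - Q₀ * P x) * T + P x * -(T * (Pi1 x * Q₁ * P x) * T)
      = -(Q₁ * P x * T * A₁) - (Q₀ - (Q₁ * X - X * Q₁)) * (P x * T) := by
    rw [Matrix.sub_mul, Matrix.neg_mul, Matrix.mul_assoc _ A₂, hAT, hX]
    simp only [Matrix.mul_sub, Matrix.sub_mul, Matrix.mul_neg, Matrix.mul_assoc]
    abel
  have hV : P x * T * R * Pi1 x = 1 - w := by rw [hw]; abel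
  have hL : Q₁ * P x * T * A₁ * R * Pi1 x = Q₁ * X + lam • (Q₁ * (1 - w)) := by
    rw [Matrix.mul_assoc _ A₁, hAR, ← hV, hX]
    simp only [Matrix.mul_add, Matrix.add_mul, Matrix.mul_one, Matrix.mul_smul, Matrix.smul_mul,
      Matrix.mul_assoc]
  have hM : P x * T * R * (A₁ * Pi1 x * Q₁) = X * Q₁ + lam • ((1 - w) * Q₁) := by
    rw [Matrix.mul_assoc A₁, ← Matrix.mul_assoc _ A₁, Matrix.mul_assoc _ R, hRA, ← hV, hX]
    simp only [Matrix.mul_add, Matrix.add_mul, Matrix.mul_one, Matrix.mul_smul, Matrix.smul_mul,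
      Matrix.mul_assoc]
  have hN : P x * T * R * (Pi1 x * Q₀) = (1 - w) * Q₀ := by rw [← hV, Matrix.mul_assoc _ (Pi1 x)]
  have hK : (Q₀ - (Q₁ * X - X * Q₁)) * (P x * T) * R * Pi1 x
      = (Q₀ - (Q₁ * X - X * Q₁)) * (1 - w) := by
    rw [← hV]; simp only [Matrix.mul_assoc]
  rw [hPT, Matrix.mul_zero, add_zero, Matrix.mul_add, hM, hN, Matrix.sub_mul, Matrix.sub_mul,
    hK, Matrix.neg_mul, Matrix.neg_mul, hL]
  simp only [Matrix.mul_sub, Matrix.sub_mul, Matrix.mul_add, Matrix.add_mul, Matrix.neg_mul,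
    Matrix.mul_one, Matrix.one_mul, Matrix.mul_smul, Matrix.smul_mul, smul_sub]
  abel

/-- **GBDT theorem for first-order systems linear in the spectral parameter.**
If `y(x,λ)` satisfies `y' = F(x,λ) y` with `F(x,λ) = −(λ Q₁(x) + Q₀(x))`, then
`ỹ(x,λ) := w_A(x,λ) y(x,λ)`, with `w_A(x,λ) = I − Π₂(x)* S(x)⁻¹ (A₁ − λ I)⁻¹ Π₁(x)`,
satisfies, at every point where `S(x)` and `A₁ − λ I` are invertible, the transformed
system `ỹ' = F̃(x,λ) ỹ`, where `F̃(x,λ) = −(λ Q₁(x) + Q̃₀(x))`,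
`Q̃₀ = Q₀ − (Q₁ X − X Q₁)`, `X = Π₂* S⁻¹ Π₁`. -/
theorem gbdt_transformed_system
    (n m : ℕ) (ℓ : ℝ) (lam : ℂ)
    (Q₁ Q₀ : ℝ → Matrix (Fin m) (Fin m) ℂ)
    (A₁ A₂ : Matrix (Fin n) (Fin n) ℂ)
    (Pi1 Pi2 : ℝ → Matrix (Fin n) (Fin m) ℂ)
    (S : ℝ → Matrix (Fin n) (Fin n) ℂ)
    (hInit : A₁ * S 0 - S 0 * A₂ = Pi1 0 * (Pi2 0)ᴴ)
    (hPi1 : ∀ x ∈ Ico (0 : ℝ) ℓ,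
      HasDerivAt Pi1 (A₁ * Pi1 x * Q₁ x + Pi1 x * Q₀ x) x)
    (hPi2 : ∀ x ∈ Ico (0 : ℝ) ℓ,
      HasDerivAt (fun t => (Pi2 t)ᴴ) (-(Q₁ x * (Pi2 x)ᴴ * A₂) - Q₀ x * (Pi2 x)ᴴ) x)
    (hS : ∀ x ∈ Ico (0 : ℝ) ℓ,
      HasDerivAt S (Pi1 x * Q₁ x * (Pi2 x)ᴴ) x)
    (wA : ℝ → Matrix (Fin m) (Fin m) ℂ)
    (hwA : wA = fun x => 1 - (Pi2 x)ᴴ * (S x)⁻¹ * (A₁ - lam • 1)⁻¹ * Pi1 x)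
    (X : ℝ → Matrix (Fin m) (Fin m) ℂ)
    (hX : X = fun x => (Pi2 x)ᴴ * (S x)⁻¹ * Pi1 x)
    (F Ft : ℝ → Matrix (Fin m) (Fin m) ℂ)
    (hF : F = fun x => -(lam • Q₁ x + Q₀ x))
    (hFt : Ft = fun x => -(lam • Q₁ x + (Q₀ x - (Q₁ x * X x - X x * Q₁ x))))
    -- the solution of the initial system
    (y : ℝ → Fin m → ℂ)
    (hy : ∀ x ∈ Ico (0 : ℝ) ℓ, HasDerivAt y (F x *ᵥ y x) x) :
    ∀ x ∈ Ico (0 : ℝ) ℓ, IsUnit (S x) → IsUnit (A₁ - lam • 1) →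
      HasDerivAt (fun t => wA t *ᵥ y t) (Ft x *ᵥ (wA x *ᵥ y x)) x := by
  subst hwA hX hF hFt
  intro x hx hSu hAu
  have hId := gbdt_operator_identity (P := fun t => (Pi2 t)ᴴ) hInit hPi1 hPi2 hS x hx
  have h := (gbdt_hasDerivAt_darboux (hPi1 x hx) (hPi2 x hx) (hS x hx) hId hSu hAu rfl
    rfl).matrix_mulVec (hy x hx)
  refine h.congr_deriv ?_
  rw [Matrix.add_mulVec, Matrix.mulVec_mulVec, Matrix.mulVec_mulVec, Matrix.mul_neg,
    Matrix.neg_mulVec, add_neg_cancel_right]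
end

section
/- Theorem (Darboux transformation of Weyl circles): let a Hamiltonian system y′ = J(λH₁(x) + H₀(x))y on [0,ℓ) be given with m = 2r, J = [[0, I_r],[−I_r, 0]], H₁(x) ≥ 0, H₁, H₀ Hermitian, and let a GBDT triple {A, S(0), Π(0)} with S(0) > 0 and AS(0) − S(0)A* = Π(0)JΠ(0)* be given; let Π(x), S(x), w_A(x,λ) be the corresponding GBDT data, Y(x,λ) the fundamental solution with Y(0,λ) = E (where EJ = JE, E*E = I_m), Ỹ(x,λ) = w_A(x,λ)Y(x,λ)E*w_A(0,λ)⁻¹E, and U(λ) = E*w_A(0,λ)E with r×r blocks U_{ij}(λ). Fix ℓ′ < ℓ and λ with Im λ > 0 and A − λI_n invertible. If an r×r matrix M satisfies i[I_r, M*]·Y(ℓ′,λ)*JY(ℓ′,λ)·[I_r; M] ≤ 0 (belongs to the Weyl circle of the initial system) and det(U₁₁(λ) + U₁₂(λ)M) ≠ 0, then M̃ := (U₂₁(λ) + U₂₂(λ)M)(U₁₁(λ) + U₁₂(λ)M)⁻¹ satisfies i[I_r, M̃*]·Ỹ(ℓ′,λ)*JỸ(ℓ′,λ)·[I_r; M̃]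 ≤ 0, i.e. M̃ belongs to the Weyl circle of the transformed system. -/
open Matrix Set
open scoped ComplexOrder

attribute [local instance] Matrix.normedAddCommGroup Matrix.normedSpace

section Helpers

variable {m n p : Type*} [Fintype m] [Fintype n] [Fintype p]

/-- Product rule for matrix-valued functions of a real variable. -/
lemma HasDerivAt.matrix_mul_s8 {F : ℝ → Matrix m n ℂ} {G : ℝ → Matrix n p ℂ}
    {F' : Matrix m n ℂ} {G' : Matrix n p ℂ} {x : ℝ}
    (hF : HasDerivAt F F' x) (hG : HasDerivAt G G' x) :
    HasDerivAt (fun t => F t * G t) (F' * G x + F x * G') x := by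
  refine hasDerivAt_pi.2 fun i => hasDerivAt_pi.2 fun j => ?_
  have hF₂ : ∀ k, HasDerivAt (fun t => F t i k) (F' i k) x := fun k =>
    hasDerivAt_pi.1 (hasDerivAt_pi.1 hF i) k
  have hG₂ : ∀ k, HasDerivAt (fun t => G t k j) (G' k j) x := fun k =>
    hasDerivAt_pi.1 (hasDerivAt_pi.1 hG k) j
  have h := HasDerivAt.fun_sum (u := Finset.univ) fun k _ => (hF₂ k).fun_mul (hG₂ k)
  simpa only [Matrix.mul_apply, Matrix.add_apply, Finset.sum_add_distrib] using h

/-- The conjugate transpose of a matrix-valued function can be differentiated entrywise. -/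
lemma HasDerivAt.matrix_conjTranspose {F : ℝ → Matrix m n ℂ} {F' : Matrix m n ℂ} {x : ℝ}
    (hF : HasDerivAt F F' x) : HasDerivAt (fun t => (F t)ᴴ) F'ᴴ x :=
  hasDerivAt_pi.2 fun i => hasDerivAt_pi.2 fun j =>
    (hasDerivAt_pi.1 (hasDerivAt_pi.1 hF j) i).star

/-- A matrix-valued function with zero derivative on `[a, b]` takes the same value at both ends. -/
lemma Matrix.eq_of_hasDerivAt_zero {F : ℝ → Matrix m n ℂ} {a b : ℝ} (hab : a ≤ b)
    (hF : ∀ x ∈ Icc a b, HasDerivAt F 0 x) : F b = F a :=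
  constant_of_has_deriv_right_zero
    (fun x hx => (hF x hx).continuousAt.continuousWithinAt)
    (fun x hx => (hF x (Ico_subset_Icc_self hx)).hasDerivWithinAt) b (right_mem_Icc.2 hab)

/-- A matrix-valued function with positive semidefinite derivative is nondecreasing in the
Loewner order. -/
lemma Matrix.posSemidef_sub_of_hasDerivAt {F F' : ℝ → Matrix n n ℂ} {a b : ℝ} (hab : a ≤ b)
    (hF : ∀ x ∈ Icc a b, HasDerivAt F (F' x) x) (hF' : ∀ x ∈ Icc a b, (F' x).PosSemidef) :
    (F b - F a).PosSemidef := by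
  have hherm : F b - (F b)ᴴ = F a - (F a)ᴴ := by
    refine Matrix.eq_of_hasDerivAt_zero (F := fun x => F x - (F x)ᴴ) hab fun x hx => ?_
    have h := (hF x hx).sub (hF x hx).matrix_conjTranspose
    rw [(hF' x hx).isHermitian.eq, sub_self] at h
    exact h
  have hsub : (F b - F a).IsHermitian := by
    rw [IsHermitian, conjTranspose_sub, ← sub_eq_zero]
    rw [← sub_eq_zero] at hherm
    rw [← neg_eq_zero, ← hherm]
    abel
  refine .of_dotProduct_mulVec_nonneg hsub fun v => ?_
  have hquad : ∀ x ∈ Icc a b, HasDerivAt (fun t => (star v ⬝ᵥ (F t *ᵥ v)).re)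
      (star v ⬝ᵥ (F' x *ᵥ v)).re x := by
    intro x hx
    have h : HasDerivAt (fun t => star v ⬝ᵥ (F t *ᵥ v)) (star v ⬝ᵥ (F' x *ᵥ v)) x :=
      HasDerivAt.fun_sum fun i _ => (HasDerivAt.fun_sum fun j _ =>
        (hasDerivAt_pi.1 (hasDerivAt_pi.1 (hF x hx) i) j).mul_const (v j)).const_mul (star v i)
    exact Complex.reCLM.hasFDerivAt.comp_hasDerivAt x h
  have hmono : MonotoneOn (fun t => (star v ⬝ᵥ (F t *ᵥ v)).re) (Icc a b) := by
    refine monotoneOn_of_deriv_nonneg (convex_Icc a b)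
      (fun x hx => (hquad x hx).continuousAt.continuousWithinAt)
      (fun x hx => (hquad x (interior_subset hx)).differentiableAt.differentiableWithinAt)
      fun x hx => ?_
    have hx' := interior_subset hx
    rw [(hquad x hx').deriv]
    exact (Complex.nonneg_iff.1 ((hF' x hx').dotProduct_mulVec_nonneg v)).1
  refine Complex.nonneg_iff.2 ⟨?_, (hsub.im_star_dotProduct_mulVec_self v).symm⟩
  rw [sub_mulVec, dotProduct_sub, Complex.sub_re, sub_nonneg]
  exact hmono (left_mem_Icc.2 hab) (right_mem_Icc.2 hab) hab

/-- The GBDT identity `A S - S A* = Π J Π*` is preserved by the flow of `Π` and `S`. -/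
lemma gbdt_identity_of_hasDerivAt {J : Matrix m m ℂ} (hJ : Jᴴ = -J)
    {H₁ H₀ : ℝ → Matrix m m ℂ} {A : Matrix n n ℂ} {P : ℝ → Matrix n m ℂ}
    {S : ℝ → Matrix n n ℂ} {a b : ℝ} (hab : a ≤ b)
    (hH₁ : ∀ x ∈ Icc a b, (H₁ x).IsHermitian) (hH₀ : ∀ x ∈ Icc a b, (H₀ x).IsHermitian)
    (hP : ∀ x ∈ Icc a b, HasDerivAt P (-(A * P x * J * H₁ x) - P x * J * H₀ x) x)
    (hS : ∀ x ∈ Icc a b, HasDerivAt S (P x * J * H₁ x * Jᴴ * (P x)ᴴ) x)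
    (hid : A * S a - S a * Aᴴ = P a * J * (P a)ᴴ) :
    A * S b - S b * Aᴴ = P b * J * (P b)ᴴ := by
  rw [← sub_eq_zero] at hid ⊢
  rw [← hid]
  refine Matrix.eq_of_hasDerivAt_zero (F := fun x => A * S x - S x * Aᴴ - P x * J * (P x)ᴴ) hab
    fun x hx => ?_
  have h := (((hasDerivAt_const x A).matrix_mul_s8 (hS x hx)).sub
    ((hS x hx).matrix_mul_s8 (hasDerivAt_const x Aᴴ))).sub
    (((hP x hx).matrix_mul_s8 (hasDerivAt_const x J)).matrix_mul_s8 (hP x hx).matrix_conjTranspose)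
  refine h.congr_deriv ?_
  simp only [conjTranspose_sub, conjTranspose_neg, conjTranspose_mul, (hH₁ x hx).eq,
    (hH₀ x hx).eq, hJ, Matrix.zero_mul, Matrix.mul_zero, zero_add, add_zero,
    Matrix.sub_mul, Matrix.mul_sub, Matrix.neg_mul, Matrix.mul_neg, Matrix.mul_assoc]
  abel

variable [DecidableEq m] [DecidableEq n]

/-- The `J`-form of the Darboux matrix `w = 1 - J Π* S⁻¹ (A - λ)⁻¹ Π`. -/
lemma darboux_conjTranspose_mul_mul_self {J : Matrix m m ℂ} (hJ : Jᴴ = -J) (hJJ : J * J = -1)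
    {A S : Matrix n n ℂ} {P : Matrix n m ℂ} {lam : ℂ} (hS : S.IsHermitian) (hSu : IsUnit S)
    (hA : IsUnit (A - lam • 1)) (hid : A * S - S * Aᴴ = P * J * Pᴴ)
    {w : Matrix m m ℂ} (hw : w = 1 - J * Pᴴ * S⁻¹ * (A - lam • 1)⁻¹ * P) :
    wᴴ * J * w = J + (lam - star lam) •
      (((A - lam • 1)⁻¹ * P)ᴴ * S⁻¹ * ((A - lam • 1)⁻¹ * P)) := by
  set B := A - lam • 1 with hB
  set X := B⁻¹ * P with hX
  have hSdet : IsUnit S.det := (isUnit_iff_isUnit_det S).1 hSu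
  have hBX : B * X = P := mul_nonsing_inv_cancel_left B P ((isUnit_iff_isUnit_det B).1 hA)
  have hK : (S⁻¹)ᴴ = S⁻¹ := hS.inv.eq
  have hSK : S * S⁻¹ = 1 := mul_nonsing_inv S hSdet
  have hKS : S⁻¹ * S = 1 := nonsing_inv_mul S hSdet
  generalize S⁻¹ = K at *
  have hid' : P * J * Pᴴ = B * S - S * Bᴴ + (lam - star lam) • S := by
    rw [← hid, hB, conjTranspose_sub, conjTranspose_smul, conjTranspose_one]
    simp only [sub_mul, mul_sub, smul_mul_assoc, mul_smul_comm, one_mul, mul_one, sub_smul]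
    abel
  have hKPK : K * (P * J * Pᴴ) * K = K * B - Bᴴ * K + (lam - star lam) • K := by
    rw [hid']
    simp only [mul_add, add_mul, mul_sub, sub_mul, smul_mul_assoc, mul_smul_comm]
    rw [hKS, one_mul, ← mul_assoc K S, hKS, one_mul, mul_assoc K (B * S), mul_assoc B, hSK,
      mul_one]
  have hw' : w = 1 - J * (Pᴴ * K * X) := by
    rw [hw, hX]; simp only [Matrix.mul_assoc]
  have hwt : wᴴ = 1 + Xᴴ * K * P * J := by
    rw [hw']
    simp only [conjTranspose_sub, conjTranspose_one, conjTranspose_mul, conjTranspose_conjTranspose,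
      hJ, hK, Matrix.mul_neg, sub_neg_eq_add, Matrix.mul_assoc]
  have hstep : wᴴ * J * w = J + Pᴴ * K * X - Xᴴ * K * P + Xᴴ * (K * (P * J * Pᴴ) * K) * X := by
    have e₁ : wᴴ * J = J - Xᴴ * K * P := by
      rw [hwt, add_mul, one_mul, mul_assoc, hJJ, mul_neg, mul_one, sub_eq_add_neg]
    rw [e₁, hw', mul_sub, mul_one, sub_mul, ← mul_assoc J J, hJJ]
    simp only [Matrix.mul_assoc, Matrix.neg_mul, Matrix.one_mul]
    abel
  rw [hstep, hKPK]
  have hXB : Xᴴ * Bᴴ = Pᴴ := by rw [← conjTranspose_mul, hBX]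
  simp only [Matrix.mul_add, Matrix.add_mul, Matrix.mul_sub, Matrix.sub_mul, Matrix.smul_mul,
    Matrix.mul_smul]
  rw [← Matrix.mul_assoc Xᴴ Bᴴ, hXB, Matrix.mul_assoc Xᴴ (K * B), Matrix.mul_assoc K B, hBX,
    ← Matrix.mul_assoc Xᴴ K P]
  abel

/-- The Darboux matrix is `J`-contractive in the upper half plane: the form `-i V* J V` does not
decrease in the Loewner order when `V` is multiplied by it. -/
lemma darboux_posSemidef {J : Matrix m m ℂ} (hJ : Jᴴ = -J) (hJJ : J * J = -1)
    {A S : Matrix n n ℂ} {P : Matrix n m ℂ} {lam : ℂ} (hlam : 0 < lam.im) (hS : S.PosDef)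
    (hA : IsUnit (A - lam • 1)) (hid : A * S - S * Aᴴ = P * J * Pᴴ)
    {w : Matrix m m ℂ} (hw : w = 1 - J * Pᴴ * S⁻¹ * (A - lam • 1)⁻¹ * P)
    {V : Matrix m p ℂ} (hV : (-(Complex.I • (Vᴴ * J * V))).PosSemidef) :
    (-(Complex.I • ((w * V)ᴴ * J * (w * V)))).PosSemidef := by
  have hform := darboux_conjTranspose_mul_mul_self hJ hJJ hS.isHermitian hS.isUnit hA hid hw
  set X := (A - lam • 1)⁻¹ * P
  have hcoef : -(Complex.I * (lam - star lam)) = ((2 * lam.im : ℝ) : ℂ) := by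
    apply Complex.ext <;> simp [two_mul]
  have hsplit : -(Complex.I • ((w * V)ᴴ * J * (w * V))) =
      -(Complex.I • (Vᴴ * J * V)) + ((2 * lam.im : ℝ) : ℂ) • ((X * V)ᴴ * S⁻¹ * (X * V)) := by
    have e : (w * V)ᴴ * J * (w * V) = Vᴴ * (wᴴ * J * w) * V := by
      simp only [conjTranspose_mul, Matrix.mul_assoc]
    rw [e, hform, ← hcoef]
    simp only [conjTranspose_mul, Matrix.mul_assoc, Matrix.mul_add, Matrix.add_mul,
      Matrix.mul_smul, Matrix.smul_mul, smul_add, smul_smul, neg_smul, neg_add]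
  rw [hsplit]
  refine hV.add ((hS.posSemidef.inv.conjTranspose_mul_mul_same (X * V)).smul ?_)
  exact Complex.zero_le_real.2 (by positivity)

end Helpers

/-- **Darboux transformation of Weyl circles for Hamiltonian systems.**  Given a Hamiltonian
system `y' = J(λH₁(x) + H₀(x))y` on `[0,ℓ)` with `m = 2r`, `J = [[0, I],[−I, 0]]`,
`H₁ ≥ 0`, `H₁, H₀` Hermitian, a GBDT triple `{A, S(0) > 0, Π(0)}` with
`A S(0) − S(0) A* = Π(0) J Π(0)*`, fundamental solution `Y` with `Y(0) = E`
(`EJ = JE`, `E*E = I`), transformed fundamental solution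
`Ỹ(x) = w_A(x,λ) Y(x) E* w_A(0,λ)⁻¹ E` and `U(λ) = E* w_A(0,λ) E`: if `M` belongs to the
Weyl circle `i [I, M*] Y(ℓ')* J Y(ℓ') [I; M] ≤ 0` of the initial system and
`det(U₁₁ + U₁₂ M) ≠ 0`, then `M̃ = (U₂₁ + U₂₂ M)(U₁₁ + U₁₂ M)⁻¹` belongs to the Weyl
circle of the transformed system. -/
theorem gbdt_weyl_circle_transformation
    (r n : ℕ) (ℓ ℓ' : ℝ) (lam : ℂ)
    (J : Matrix (Fin r ⊕ Fin r) (Fin r ⊕ Fin r) ℂ)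
    (hJdef : J = Matrix.fromBlocks 0 1 (-1) 0)
    (H₁ H₀ : ℝ → Matrix (Fin r ⊕ Fin r) (Fin r ⊕ Fin r) ℂ)
    (hH₁ : ∀ x ∈ Ico (0 : ℝ) ℓ, (H₁ x).PosSemidef)
    (hH₀ : ∀ x ∈ Ico (0 : ℝ) ℓ, (H₀ x).IsHermitian)
    (A : Matrix (Fin n) (Fin n) ℂ)
    (Pi : ℝ → Matrix (Fin n) (Fin r ⊕ Fin r) ℂ)
    (S : ℝ → Matrix (Fin n) (Fin n) ℂ)
    (hS0 : (S 0).PosDef)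
    (hInit : A * S 0 - S 0 * Aᴴ = Pi 0 * J * (Pi 0)ᴴ)
    (hPi : ∀ x ∈ Ico (0 : ℝ) ℓ,
      HasDerivAt Pi (-(A * Pi x * J * H₁ x) - Pi x * J * H₀ x) x)
    (hS : ∀ x ∈ Ico (0 : ℝ) ℓ,
      HasDerivAt S (Pi x * J * H₁ x * Jᴴ * (Pi x)ᴴ) x)
    (wA : ℝ → Matrix (Fin r ⊕ Fin r) (Fin r ⊕ Fin r) ℂ)
    (hwA : wA = fun x => 1 - J * (Pi x)ᴴ * (S x)⁻¹ * (A - lam • 1)⁻¹ * Pi x)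
    (E : Matrix (Fin r ⊕ Fin r) (Fin r ⊕ Fin r) ℂ)
    (hEJ : E * J = J * E) (hEunit : Eᴴ * E = 1)
    (Y : ℝ → Matrix (Fin r ⊕ Fin r) (Fin r ⊕ Fin r) ℂ)
    (hY0 : Y 0 = E)
    (hY : ∀ x ∈ Ico (0 : ℝ) ℓ,
      HasDerivAt Y ((J * (lam • H₁ x + H₀ x)) * Y x) x)
    (Yt : ℝ → Matrix (Fin r ⊕ Fin r) (Fin r ⊕ Fin r) ℂ)
    (hYt : Yt = fun x => wA x * Y x * Eᴴ * (wA 0)⁻¹ * E)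
    (U : Matrix (Fin r ⊕ Fin r) (Fin r ⊕ Fin r) ℂ)
    (hU : U = Eᴴ * wA 0 * E)
    (hℓ' : ℓ' ∈ Ico (0 : ℝ) ℓ)
    (hlam : 0 < lam.im)
    (hA : IsUnit (A - lam • 1))
    (M : Matrix (Fin r) (Fin r) ℂ)
    -- `M` belongs to the Weyl circle of the initial system
    (hM : (-(Complex.I • ((Matrix.fromRows (1 : Matrix (Fin r) (Fin r) ℂ) M)ᴴ * (Y ℓ')ᴴ * J * Y ℓ' *
        Matrix.fromRows (1 : Matrix (Fin r) (Fin r) ℂ) M))).PosSemidef)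
    (hdet : (U.toBlocks₁₁ + U.toBlocks₁₂ * M).det ≠ 0)
    (Mt : Matrix (Fin r) (Fin r) ℂ)
    (hMt : Mt = (U.toBlocks₂₁ + U.toBlocks₂₂ * M) *
      (U.toBlocks₁₁ + U.toBlocks₁₂ * M)⁻¹) :
    (-(Complex.I • ((Matrix.fromRows (1 : Matrix (Fin r) (Fin r) ℂ) Mt)ᴴ * (Yt ℓ')ᴴ * J * Yt ℓ' *
        Matrix.fromRows (1 : Matrix (Fin r) (Fin r) ℂ) Mt))).PosSemidef := by
  have hJ : Jᴴ = -J := by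
    rw [hJdef]; simp [fromBlocks_conjTranspose, fromBlocks_neg]
  have hJJ : J * J = -1 := by
    rw [hJdef]; simp [fromBlocks_multiply, ← fromBlocks_one, fromBlocks_neg]
  by_cases hw0 : IsUnit (wA 0).det
  swap
  · have hYt0 : Yt ℓ' = 0 := by rw [hYt]; simp [nonsing_inv_apply_not_isUnit _ hw0]
    rw [hYt0]
    simpa using PosSemidef.zero
  have hsub : Icc 0 ℓ' ⊆ Ico 0 ℓ := Icc_subset_Ico_right hℓ'.2
  have hid : A * S ℓ' - S ℓ' * Aᴴ = Pi ℓ' * J * (Pi ℓ')ᴴ :=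
    gbdt_identity_of_hasDerivAt hJ hℓ'.1 (fun x hx => (hH₁ x (hsub hx)).isHermitian)
      (fun x hx => hH₀ x (hsub hx)) (fun x hx => hPi x (hsub hx)) (fun x hx => hS x (hsub hx))
      hInit
  have hSpos : (S ℓ').PosDef := by
    have h := posSemidef_sub_of_hasDerivAt hℓ'.1 (fun x hx => hS x (hsub hx)) fun x hx => by
      have := (hH₁ x (hsub hx)).mul_mul_conjTranspose_same (Pi x * J)
      simpa only [conjTranspose_mul, Matrix.mul_assoc] using this
    simpa using hS0.add_posSemidef h
  set D := U.toBlocks₁₁ + U.toBlocks₁₂ * M with hD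
  have hDu : IsUnit D.det := isUnit_iff_ne_zero.2 hdet
  have hrows : fromRows (1 : Matrix (Fin r) (Fin r) ℂ) Mt =
      U * fromRows (1 : Matrix (Fin r) (Fin r) ℂ) M * D⁻¹ := by
    have hUM : U * fromRows (1 : Matrix (Fin r) (Fin r) ℂ) M =
        fromRows D (U.toBlocks₂₁ + U.toBlocks₂₂ * M) := by
      conv_lhs => rw [← fromBlocks_toBlocks U]
      rw [fromBlocks_mul_fromRows, Matrix.mul_one, Matrix.mul_one]
    rw [hUM, fromRows_mul, mul_nonsing_inv D hDu, hMt]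
  have hEE : E * Eᴴ = 1 := mul_eq_one_comm.1 hEunit
  have hcancel : Eᴴ * (wA 0)⁻¹ * E * U = 1 := by
    rw [hU]
    calc Eᴴ * (wA 0)⁻¹ * E * (Eᴴ * wA 0 * E)
        = Eᴴ * (wA 0)⁻¹ * (E * Eᴴ) * wA 0 * E := by simp only [Matrix.mul_assoc]
      _ = Eᴴ * ((wA 0)⁻¹ * wA 0) * E := by rw [hEE, mul_one]; simp only [Matrix.mul_assoc]
      _ = 1 := by rw [nonsing_inv_mul _ hw0, mul_one, hEunit]
  have htransform : Yt ℓ' * fromRows (1 : Matrix (Fin r) (Fin r) ℂ) Mt =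
      wA ℓ' * (Y ℓ' * fromRows (1 : Matrix (Fin r) (Fin r) ℂ) M * D⁻¹) := by
    rw [hrows, hYt]
    calc wA ℓ' * Y ℓ' * Eᴴ * (wA 0)⁻¹ * E *
          (U * fromRows (1 : Matrix (Fin r) (Fin r) ℂ) M * D⁻¹)
        = wA ℓ' * Y ℓ' * (Eᴴ * (wA 0)⁻¹ * E * U) *
          fromRows (1 : Matrix (Fin r) (Fin r) ℂ) M * D⁻¹ := by
          simp only [Matrix.mul_assoc]
      _ = _ := by rw [hcancel, Matrix.mul_one]; simp only [Matrix.mul_assoc]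
  have hV : (-(Complex.I • ((Y ℓ' * fromRows (1 : Matrix (Fin r) (Fin r) ℂ) M * D⁻¹)ᴴ * J *
      (Y ℓ' * fromRows (1 : Matrix (Fin r) (Fin r) ℂ) M * D⁻¹)))).PosSemidef := by
    have h := hM.conjTranspose_mul_mul_same D⁻¹
    simpa only [conjTranspose_mul, Matrix.mul_assoc, Matrix.mul_neg, Matrix.neg_mul,
      Matrix.mul_smul, Matrix.smul_mul] using h
  have h := darboux_posSemidef hJ hJJ hlam hSpos hA hid (congrFun hwA ℓ') hV
  rw [← htransform] at h
  simpa only [conjTranspose_mul, Matrix.mul_assoc] using h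
end

section
/- Lemma (automatic nondegeneracy): let r ∈ ℕ, J = [[0, I_r],[−I_r, 0]], and let U be a 2r×2r matrix with r×r blocks U_{ij} satisfying i·U*JU ≤ i·J. If an r×r matrix M satisfies i(M − M*) < 0 (negative definite), then det(U₁₁ + U₁₂M) ≠ 0. -/
open Matrix
open scoped ComplexOrder

/-- **Automatic nondegeneracy.**  Let `J = [[0, I],[−I, 0]]` and let `U` be a `2r×2r` matrix
with `r×r` blocks `U_{ij}` satisfying `i U* J U ≤ i J`.  If `M` satisfies `i(M − M*) < 0`
(negative definite), then `det(U₁₁ + U₁₂ M) ≠ 0`. -/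
theorem weyl_circle_nondegeneracy
    (r : ℕ)
    (J : Matrix (Fin r ⊕ Fin r) (Fin r ⊕ Fin r) ℂ)
    (hJdef : J = Matrix.fromBlocks 0 1 (-1) 0)
    (U : Matrix (Fin r ⊕ Fin r) (Fin r ⊕ Fin r) ℂ)
    (hU : (Complex.I • J - Complex.I • (Uᴴ * J * U)).PosSemidef)
    (M : Matrix (Fin r) (Fin r) ℂ)
    (hM : (-(Complex.I • (M - Mᴴ))).PosDef) :
    (U.toBlocks₁₁ + U.toBlocks₁₂ * M).det ≠ 0 := by
  subst hJdef
  intro hdet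
  obtain ⟨v, hv, hker⟩ := Matrix.exists_mulVec_eq_zero_iff.mpr hdet
  set w : Fin r ⊕ Fin r → ℂ := Sum.elim v (M *ᵥ v) with hw
  have hUw : U *ᵥ w = Sum.elim (0 : Fin r → ℂ) (U.toBlocks₂₁ *ᵥ v + U.toBlocks₂₂ *ᵥ (M *ᵥ v)) := by
    conv_lhs => rw [← U.fromBlocks_toBlocks]
    rw [hw, Matrix.fromBlocks_mulVec, Sum.elim_comp_inl, Sum.elim_comp_inr, ← hker,
      Matrix.add_mulVec, Matrix.mulVec_mulVec]
  have hpos := hM.dotProduct_mulVec_pos hv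
  have hnonneg := hU.dotProduct_mulVec_nonneg w
  have hisotropic : star w ⬝ᵥ ((Uᴴ * fromBlocks 0 1 (-1) 0 * U) *ᵥ w) = 0 := by
    rw [Matrix.mul_assoc, ← Matrix.mulVec_mulVec, Matrix.dotProduct_mulVec,
      ← Matrix.star_mulVec, ← Matrix.mulVec_mulVec, hUw, Matrix.fromBlocks_mulVec]
    simp [dotProduct, Fintype.sum_sum_type]
  have hform : star w ⬝ᵥ ((fromBlocks 0 1 (-1) 0 : Matrix (Fin r ⊕ Fin r) (Fin r ⊕ Fin r) ℂ) *ᵥ w)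
      = star v ⬝ᵥ ((M - Mᴴ) *ᵥ v) := by
    have hadj : star v ⬝ᵥ (Mᴴ *ᵥ v) = star (M *ᵥ v) ⬝ᵥ v := by
      rw [Matrix.dotProduct_mulVec, ← Matrix.star_mulVec]
    rw [Matrix.sub_mulVec, dotProduct_sub, hadj, hw, Matrix.fromBlocks_mulVec]
    simp [dotProduct, Matrix.neg_mulVec, Fintype.sum_sum_type, sub_eq_add_neg]
  rw [Matrix.sub_mulVec, Matrix.smul_mulVec, Matrix.smul_mulVec, dotProduct_sub,
    dotProduct_smul, dotProduct_smul, hisotropic, hform, smul_zero, sub_zero] at hnonneg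
  rw [Matrix.neg_mulVec, Matrix.smul_mulVec, dotProduct_neg, dotProduct_smul] at hpos
  exact (neg_pos.mp hpos).not_ge hnonneg
end
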